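/- arXiv:1912.09289 — 2 statements merged into one kernel-verified Lean document; each statement's English description precedes it below -/
import Mathlib

section
/- Let ν be a σ-finite Borel measure on ℝ with ν({0}) = 0 and K_ν := ∫_ℝ (y² ∧ 1) ν(dy) < ∞, let α ≥ 0 be a constant, let β : ℝ → ℝ be Borel measurable with 0 ≤ β(y) ≤ α(|y| ∧ 1) for all y, let σ > 0, and let ζ, θ ∈ ℝ satisfy ε₂ ≤ ζ² ≤ ε₁ and θ² ≤ M for constants 0 < ε₂ < ε₁ and M ≥ 0. Define G(c) := (σ²/2)(c ζ − θ/σ²)² + ∫_ℝ (c β(y) − log(1 + c β(y))) ν(dy) for c ≥ 0. Then there exist constants k₁, k₂ > 0, depending only on σ, ε₁, ε₂, M, α and K_ν (and not on ζ, θ, β or C), such that for every nonempty closed set C ⊆ [0, ∞) and every minimizer c* ∈ C of G over C (i.e. G(c*) = inf_{c ∈ C} G(c)), one has (c*)² ≤ k₁ c² + k₂ for every c ∈ C. -/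
open MeasureTheory

/-- The function `G(c) = (σ²/2)(cζ - θ/σ²)² + ∫ (c β y - log(1 + c β y)) dν`. -/
noncomputable def levyLogG (ν : Measure ℝ) (β : ℝ → ℝ) (σ ζ θ : ℝ) (c : ℝ) : ℝ :=
  σ ^ 2 / 2 * (c * ζ - θ / σ ^ 2) ^ 2
    + ∫ y, (c * β y - Real.log (1 + c * β y)) ∂ν

lemma aux_sub_log_bounds {x : ℝ} (hx : 0 ≤ x) :
    0 ≤ x - Real.log (1 + x) ∧ x - Real.log (1 + x) ≤ x ^ 2 := by
  have h1 : 0 < 1 + x := by linarith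
  have h2 := Real.log_le_sub_one_of_pos h1
  have h3 := Real.one_sub_inv_le_log_of_pos h1
  refine ⟨by linarith, ?_⟩
  have h4 : x - (1 - (1 + x)⁻¹) ≤ x ^ 2 := by
    have h5 : x - (1 - (1 + x)⁻¹) = x ^ 2 / (1 + x) := by
      field_simp
      ring
    rw [h5]
    exact div_le_self (sq_nonneg x) (by linarith)
  linarith

/-- There are constants `k₁, k₂ > 0`, depending only on `σ`, `ε₁`, `ε₂`, `M`, `α`
and `K_ν = ∫ (y² ∧ 1) dν` (and not on `ζ`, `θ`, `β` or `C`), such that for every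
`ζ, θ` with `ε₂ ≤ ζ² ≤ ε₁`, `θ² ≤ M`, every admissible `β`, every nonempty closed
`C ⊆ [0, ∞)` and every minimizer `c* ∈ C` of `G` over `C`, one has
`(c*)² ≤ k₁ c² + k₂` for all `c ∈ C`. -/
theorem levyLogG_minimizer_quadratic_bound
    (ν : Measure ℝ) [SigmaFinite ν] (hν0 : ν {0} = 0)
    (hνint : Integrable (fun y : ℝ => min (y ^ 2) 1) ν)
    (α : ℝ) (hα : 0 ≤ α) (σ : ℝ) (hσ : 0 < σ)
    (ε₁ ε₂ M : ℝ) (hε₂ : 0 < ε₂) (hε : ε₂ < ε₁) (hM : 0 ≤ M) :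
    ∃ k₁ > (0 : ℝ), ∃ k₂ > (0 : ℝ),
      ∀ ζ θ : ℝ, ε₂ ≤ ζ ^ 2 → ζ ^ 2 ≤ ε₁ → θ ^ 2 ≤ M →
      ∀ β : ℝ → ℝ, Measurable β → (∀ y, 0 ≤ β y ∧ β y ≤ α * min |y| 1) →
      ∀ C : Set ℝ, C.Nonempty → IsClosed C → C ⊆ Set.Ici (0 : ℝ) →
      ∀ cstar ∈ C, (∀ c ∈ C, levyLogG ν β σ ζ θ cstar ≤ levyLogG ν β σ ζ θ c) →
      ∀ c ∈ C, cstar ^ 2 ≤ k₁ * c ^ 2 + k₂ := by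
  set K : ℝ := ∫ y, min (y ^ 2) 1 ∂ν with hK
  have hK0 : 0 ≤ K := integral_nonneg (fun y => le_min (sq_nonneg y) zero_le_one)
  have hε₁ : 0 < ε₁ := hε₂.trans hε
  refine ⟨(4 * ε₁ + 4 * (α ^ 2 * K / σ ^ 2)) / ε₂, by positivity,
    6 * (M / (σ ^ 2) ^ 2) / ε₂ + 1, by positivity, ?_⟩
  intro ζ θ hζ₁ hζ₂ hθ β _ hβ C _ _ hC0 s hs hmin c hc
  have hc0 : 0 ≤ c := hC0 hc
  have hs0 : 0 ≤ s := hC0 hs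
  have hnn : ∀ a : ℝ, 0 ≤ a → ∀ y, 0 ≤ a * β y - Real.log (1 + a * β y) := fun a ha y =>
    (aux_sub_log_bounds (mul_nonneg ha (hβ y).1)).1
  have hI0 : 0 ≤ ∫ y, (s * β y - Real.log (1 + s * β y)) ∂ν := integral_nonneg (hnn s hs0)
  have hI1 : ∫ y, (c * β y - Real.log (1 + c * β y)) ∂ν ≤ α ^ 2 * c ^ 2 * K := by
    rw [hK, ← integral_const_mul]
    refine integral_mono_of_nonneg (Filter.Eventually.of_forall (hnn c hc0))
      (hνint.const_mul _) (Filter.Eventually.of_forall fun y => ?_)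
    refine (aux_sub_log_bounds (mul_nonneg hc0 (hβ y).1)).2.trans ?_
    have h1 : β y ^ 2 ≤ (α * min |y| 1) ^ 2 := pow_le_pow_left₀ (hβ y).1 (hβ y).2 2
    have h2 : (min |y| 1) ^ 2 ≤ min (y ^ 2) 1 := by
      have h0 : 0 ≤ min |y| 1 := le_min (abs_nonneg y) zero_le_one
      refine le_min ?_ ?_
      · rw [← sq_abs y]
        exact pow_le_pow_left₀ h0 (min_le_left _ _) 2
      · exact pow_le_one₀ h0 (min_le_right _ _)
    calc (c * β y) ^ 2 = c ^ 2 * β y ^ 2 := by ring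
      _ ≤ c ^ 2 * (α * min |y| 1) ^ 2 := by gcongr
      _ = α ^ 2 * c ^ 2 * (min |y| 1) ^ 2 := by ring
      _ ≤ α ^ 2 * c ^ 2 * min (y ^ 2) 1 := by gcongr
  have hG := hmin c hc
  unfold levyLogG at hG
  have ht : (θ / σ ^ 2) ^ 2 ≤ M / (σ ^ 2) ^ 2 := by
    rw [div_pow]
    gcongr
  set t := θ / σ ^ 2
  have hσ2 : 0 < σ ^ 2 := by positivity
  have hkey : (s * ζ - t) ^ 2 ≤ (c * ζ - t) ^ 2 + 2 * (α ^ 2 * K / σ ^ 2) * c ^ 2 := by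
    have h1 : σ ^ 2 / 2 * (s * ζ - t) ^ 2
        ≤ σ ^ 2 / 2 * ((c * ζ - t) ^ 2 + 2 * (α ^ 2 * K / σ ^ 2) * c ^ 2) := by
      have h2 : σ ^ 2 / 2 * ((c * ζ - t) ^ 2 + 2 * (α ^ 2 * K / σ ^ 2) * c ^ 2)
          = σ ^ 2 / 2 * (c * ζ - t) ^ 2 + α ^ 2 * c ^ 2 * K := by
        field_simp
      rw [h2]
      linarith
    exact le_of_mul_le_mul_left h1 (by positivity)
  set D := α ^ 2 * K / σ ^ 2
  have h3 : s ^ 2 * ε₂ ≤ s ^ 2 * ζ ^ 2 := by gcongr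
  have h4 : c ^ 2 * ζ ^ 2 ≤ c ^ 2 * ε₁ := by gcongr
  have h5 : s ^ 2 * ε₂ ≤ (4 * ε₁ + 4 * D) * c ^ 2 + 6 * (M / (σ ^ 2) ^ 2) := by
    nlinarith [sq_nonneg (s * ζ - 2 * t), sq_nonneg (c * ζ + t)]
  have h6 : s ^ 2 ≤ ((4 * ε₁ + 4 * D) * c ^ 2 + 6 * (M / (σ ^ 2) ^ 2)) / ε₂ :=
    (le_div_iff₀ hε₂).2 h5
  have h7 : ((4 * ε₁ + 4 * D) * c ^ 2 + 6 * (M / (σ ^ 2) ^ 2)) / ε₂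
      = (4 * ε₁ + 4 * D) / ε₂ * c ^ 2 + 6 * (M / (σ ^ 2) ^ 2) / ε₂ := by ring
  linarith
end

section
/- Let (X, 𝒜) be a measurable space, let C ⊆ ℝ be a nonempty closed set, and let G : X × ℝ → ℝ be such that (i) for every x ∈ X the map c ↦ G(x, c) is continuous on C, (ii) for every c ∈ C the map x ↦ G(x, c) is measurable, and (iii) for every x ∈ X there exists c* ∈ C with G(x, c*) = inf_{c ∈ C} G(x, c). Then there exists a measurable function ρ* : X → ℝ such that ρ*(x) ∈ C and G(x, ρ*(x)) = min_{c ∈ C} G(x, c) for every x ∈ X. -/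
theorem approx_aux {f : ℝ → ℝ} {s t : Set ℝ} (hf : ContinuousOn f s) (hts : t ⊆ s)
    (hst : s ⊆ closure t) {c y : ℝ} (hc : c ∈ s) (hy : f c < y) : ∃ d ∈ t, f d < y := by
  have h1 : ContinuousWithinAt f t c := (hf c hc).mono hts
  have : (nhdsWithin c t).NeBot := mem_closure_iff_nhdsWithin_neBot.1 (hst hc)
  have h2 : ∀ᶠ d in nhdsWithin c t, f d < y := h1.eventually (Iio_mem_nhds hy)
  obtain ⟨d, hd, hd'⟩ := (h2.and self_mem_nhdsWithin).exists
  exact ⟨d, hd', hd⟩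

theorem hit_meas
    {X : Type*} [MeasurableSpace X]
    (C : Set ℝ) (hCcl : IsClosed C)
    (G : X → ℝ → ℝ)
    (hcont : ∀ x, ContinuousOn (G x) C)
    (hmeas : ∀ c ∈ C, Measurable fun x => G x c) (a b : ℝ) :
    MeasurableSet {x | ∃ c ∈ C ∩ Set.Icc a b, ∀ c' ∈ C, G x c ≤ G x c'} := by
  have hK : IsCompact (C ∩ Set.Icc a b) := isCompact_Icc.inter_left hCcl
  rcases (C ∩ Set.Icc a b).eq_empty_or_nonempty with he | hne
  · simp [he]
  obtain ⟨E, hEC, hEc, hE⟩ :=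
    (TopologicalSpace.IsSeparable.of_separableSpace C).exists_countable_dense_subset
  obtain ⟨D, hDC, hDc, hD⟩ :=
    (TopologicalSpace.IsSeparable.of_separableSpace (C ∩ Set.Icc a b)).exists_countable_dense_subset
  have key : {x | ∃ c ∈ C ∩ Set.Icc a b, ∀ c' ∈ C, G x c ≤ G x c'} =
      ⋂ e ∈ E, ⋂ n : ℕ, ⋃ d ∈ D, {x | G x d < G x e + 1 / ((n : ℝ) + 1)} := by
    ext x
    simp only [Set.mem_setOf_eq, Set.mem_iInter, Set.mem_iUnion, exists_prop]
    constructor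
    · rintro ⟨c, hc, hmin⟩ e he n
      have hp : (0 : ℝ) < 1 / ((n : ℝ) + 1) := Nat.one_div_pos_of_nat
      have := hmin e (hEC he)
      exact approx_aux ((hcont x).mono Set.inter_subset_left) hDC hD hc (by linarith)
    · intro h
      obtain ⟨c, hc, hmin⟩ := hK.exists_isMinOn hne ((hcont x).mono Set.inter_subset_left)
      refine ⟨c, hc, fun c' hc' => ?_⟩
      by_contra! hlt
      obtain ⟨e, he, hlt'⟩ := approx_aux (hcont x) hEC hE hc' hlt
      obtain ⟨n, hn⟩ := exists_nat_one_div_lt (sub_pos.2 hlt')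
      obtain ⟨d, hd, hd'⟩ := h e he n
      have : G x c ≤ G x d := hmin (hDC hd)
      linarith
  rw [key]
  refine MeasurableSet.biInter hEc fun e he => MeasurableSet.iInter fun n =>
    MeasurableSet.biUnion hDc fun d hd => ?_
  exact measurableSet_lt (hmeas d (hDC hd).1) ((hmeas e (hEC he)).add_const _)

/-- Measurable selection of a minimizer (Filippov's implicit function theorem):
if `C ⊆ ℝ` is nonempty and closed, `c ↦ G x c` is continuous on `C` for each
`x`, `x ↦ G x c` is measurable for each `c ∈ C`, and for each `x` the infimum
of `G x` over `C` is attained, then there is a measurable `ρ* : X → ℝ` with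
`ρ* x ∈ C` and `G x (ρ* x) = min_{c ∈ C} G x c` for every `x`. -/
theorem measurable_argmin_selection
    {X : Type*} [MeasurableSpace X]
    (C : Set ℝ) (hCne : C.Nonempty) (hCcl : IsClosed C)
    (G : X → ℝ → ℝ)
    (hcont : ∀ x, ContinuousOn (G x) C)
    (hmeas : ∀ c ∈ C, Measurable fun x => G x c)
    (hattained : ∀ x, ∃ cstar ∈ C, ∀ c ∈ C, G x cstar ≤ G x c) :
    ∃ ρ : X → ℝ, Measurable ρ ∧
      ∀ x, ρ x ∈ C ∧ G x (ρ x) = sInf (G x '' C) := by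
  classical
  let H : ℝ → ℝ → Set X := fun a b => {x | ∃ c ∈ C ∩ Set.Icc a b, ∀ c' ∈ C, G x c ≤ G x c'}
  have hH : ∀ a b, MeasurableSet (H a b) := hit_meas C hCcl G hcont hmeas
  have hex : ∀ x, ∃ n : ℕ, x ∈ H (-n) n := by
    intro x
    obtain ⟨c, hc, hmin⟩ := hattained x
    obtain ⟨n, hn⟩ := exists_nat_ge |c|
    exact ⟨n, c, ⟨hc, abs_le.1 hn⟩, hmin⟩
  -- the least minimizer in the first interval `[-n, n]` that contains one
  have hsel : ∀ x, ∃ r : ℝ, r ∈ C ∧ (∀ c' ∈ C, G x r ≤ G x c') ∧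
      ∃ n : ℕ, x ∈ H (-n) n ∧ (∀ m : ℕ, m < n → x ∉ H (-m) m) ∧
        r ∈ Set.Icc (-n : ℝ) n ∧
        ∀ c ∈ C ∩ Set.Icc (-n : ℝ) n, (∀ c' ∈ C, G x c ≤ G x c') → r ≤ c := by
    intro x
    obtain ⟨c0, hc0, hmin0⟩ := Nat.find_spec (hex x)
    set n := Nat.find (hex x) with hn
    have hK : IsCompact (C ∩ Set.Icc (-n : ℝ) n) := isCompact_Icc.inter_left hCcl
    have hM : IsCompact ((C ∩ Set.Icc (-n : ℝ) n) ∩ G x ⁻¹' Set.Iic (G x c0)) :=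
      hK.of_isClosed_subset
        (((hcont x).mono Set.inter_subset_left).preimage_isClosed_of_isClosed
          hK.isClosed isClosed_Iic) Set.inter_subset_left
    obtain ⟨r, hr, hrl⟩ := hM.exists_isLeast ⟨c0, hc0, le_refl (G x c0)⟩
    refine ⟨r, hr.1.1, fun c' hc' => le_trans hr.2 (hmin0 c' hc'), n, ⟨c0, hc0, hmin0⟩,
      fun m hm => Nat.find_min (hex x) hm, hr.1.2, fun c hc hcm => hrl ⟨hc, hcm c0 hc0.1⟩⟩
  choose ρ hρC hρmin N hN hNmin hρI hρle using hsel
  refine ⟨ρ, measurable_of_Iic fun t => ?_, fun x => ⟨hρC x, ?_⟩⟩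
  · have key : ρ ⁻¹' Set.Iic t =
        ⋃ n : ℕ, (H (-n) n ∩ ⋂ m : ℕ, ⋂ _ : m < n, (H (-m) m)ᶜ) ∩ H (-n) (min t n) := by
      ext x
      simp only [Set.mem_preimage, Set.mem_Iic, Set.mem_iUnion, Set.mem_inter_iff,
        Set.mem_iInter, Set.mem_compl_iff]
      constructor
      · intro h
        exact ⟨N x, ⟨hN x, hNmin x⟩, ρ x, ⟨hρC x, (hρI x).1, le_min h (hρI x).2⟩, hρmin x⟩
      · rintro ⟨n, ⟨h1, h2⟩, c, ⟨hc, hc1, hc2⟩, hcm⟩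
        have hnN : n = N x := by
          rcases lt_trichotomy n (N x) with h | h | h
          · exact absurd h1 (hNmin x n h)
          · exact h
          · exact absurd (hN x) (h2 _ h)
        subst hnN
        exact (hρle x c ⟨hc, hc1, hc2.trans (min_le_right _ _)⟩ hcm).trans
          (hc2.trans (min_le_left _ _))
    rw [key]
    exact MeasurableSet.iUnion fun n => ((hH _ _).inter (MeasurableSet.iInter fun m =>
      MeasurableSet.iInter fun _ => (hH _ _).compl)).inter (hH _ _)
  · have : IsLeast (G x '' C) (G x (ρ x)) :=
      ⟨⟨_, hρC x, rfl⟩, by rintro _ ⟨c, hc, rfl⟩; exact hρmin x c hc⟩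
    exact this.csInf_eq.symm
end
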